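/- Let δ ∈ (0, 1/2) and let f : S² → ℝ be C¹ with ‖f‖_{C¹} sufficiently small. Define, for v ∈ ℝ³ with |v| ≤ δ, the function f_v on S² determined by {v + (1 + f(θ))θ : θ ∈ S²} = {(1 + f_v(θ))θ : θ ∈ S²}. Then the map Ξ(v) = v − (3/(4π))∫_{S²}(x¹,x²,x³) f_v, satisfying Ξ(v) = O(|v|²) + O(‖f‖_{C¹}), has a fixed point v with |v| ≤ δ; for this v the translated graph function f' = f_v satisfies ∫_{S²} xⁱ f' = 0 for i = 1,2,3. -/

import Mathlib

open MeasureTheory Metric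

noncomputable section

local notation "E" => EuclideanSpace ℝ (Fin 3)

/-- The radial projection is Lipschitz at `x`, with constant `2 / ‖x‖`. -/
theorem aux_unit_lip (x y : E) (hx : x ≠ 0) :
    ‖‖y‖⁻¹ • y - ‖x‖⁻¹ • x‖ ≤ 2 / ‖x‖ * ‖y - x‖ := by
  have hx' : 0 < ‖x‖ := norm_pos_iff.2 hx
  have h1 : ‖y‖⁻¹ • y - ‖x‖⁻¹ • x = ‖x‖⁻¹ • ((‖x‖ - ‖y‖) • (‖y‖⁻¹ • y) + (y - x)) := by
    by_cases hy : y = 0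
    · simp [hy]
    · have hy' : ‖y‖ ≠ 0 := norm_ne_zero_iff.2 hy
      have : ‖x‖ ≠ 0 := hx'.ne'
      match_scalars <;> field_simp
      ring
  have h2 : ‖‖y‖⁻¹ • y‖ ≤ 1 := by
    by_cases hy : y = 0
    · simp [hy]
    · rw [norm_smul, norm_inv, norm_norm, inv_mul_cancel₀ (norm_ne_zero_iff.2 hy)]
  rw [h1, norm_smul, norm_inv, norm_norm, div_eq_inv_mul, mul_assoc]
  gcongr
  refine (norm_add_le _ _).trans ?_
  rw [norm_smul, Real.norm_eq_abs]
  have h3 : |‖x‖ - ‖y‖| ≤ ‖y - x‖ := by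
    rw [abs_sub_comm]; exact abs_norm_sub_norm_le y x
  have := mul_le_mul h3 h2 (norm_nonneg _) (norm_nonneg _)
  linarith

/-- The homogeneous extension of `θ ↦ f θ • θ`. -/
def auxH (f : E → ℝ) (x : E) : E := f (‖x‖⁻¹ • x) • x

theorem auxH_contDiffAt (f : E → ℝ) (hf : ContDiff ℝ 1 f) (x : E) (hx : x ≠ 0) :
    ContDiffAt ℝ 1 (auxH f) x := by
  have hn : ContDiffAt ℝ 1 (fun y : E => ‖y‖⁻¹) x :=
    (contDiffAt_norm ℝ hx).inv (norm_ne_zero_iff.2 hx)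
  have hu : ContDiffAt ℝ 1 (fun y : E => ‖y‖⁻¹ • y) x := hn.smul contDiffAt_id
  exact (hf.contDiffAt.comp x hu).smul contDiffAt_id

theorem auxH_fderiv (f : E → ℝ) (hf : ContDiff ℝ 1 f) (ε : ℝ)
    (hε : ∀ x ∈ sphere (0 : E) 1, |f x| ≤ ε ∧ ‖fderiv ℝ f x‖ ≤ ε) (x : E) (hx : x ≠ 0) :
    ‖fderiv ℝ (auxH f) x‖ ≤ 3 * ε := by
  have hx' : 0 < ‖x‖ := norm_pos_iff.2 hx
  have hn : ContDiffAt ℝ 1 (fun y : E => ‖y‖⁻¹) x :=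
    (contDiffAt_norm ℝ hx).inv (norm_ne_zero_iff.2 hx)
  have hu : ContDiffAt ℝ 1 (fun y : E => ‖y‖⁻¹ • y) x := hn.smul contDiffAt_id
  have hud := (hu.differentiableAt one_ne_zero).hasFDerivAt
  have hub : ‖fderiv ℝ (fun y : E => ‖y‖⁻¹ • y) x‖ ≤ 2 / ‖x‖ :=
    norm_fderiv_le_of_lip' ℝ (by positivity)
      (Filter.Eventually.of_forall fun y => aux_unit_lip x y hx)
  have hs : ‖x‖⁻¹ • x ∈ sphere (0 : E) 1 := by
    rw [mem_sphere_zero_iff_norm, norm_smul, norm_inv, norm_norm, inv_mul_cancel₀ hx'.ne']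
  obtain ⟨h1, h2⟩ := hε _ hs
  have hfd := ((hf.differentiable one_ne_zero) (‖x‖⁻¹ • x)).hasFDerivAt
  have hc := (HasFDerivAt.comp (f := fun y : E => ‖y‖⁻¹ • y) x hfd hud).smul (hasFDerivAt_id x)
  have heq : fderiv ℝ (auxH f) x = _ := hc.fderiv
  rw [heq]
  have hε0 : 0 ≤ ε := (abs_nonneg _).trans h1
  refine (norm_add_le _ _).trans ?_
  have e1 : ‖(f ∘ fun y : E => ‖y‖⁻¹ • y) x • ContinuousLinearMap.id ℝ E‖ ≤ ε := by
    rw [norm_smul]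
    calc _ ≤ ε * 1 := mul_le_mul h1 ContinuousLinearMap.norm_id_le (norm_nonneg _) hε0
      _ = ε := mul_one _
  have e2 : ‖((fderiv ℝ f (‖x‖⁻¹ • x)) ∘SL (fderiv ℝ (fun y : E => ‖y‖⁻¹ • y) x)).smulRight (id x)‖
      ≤ 2 * ε := by
    rw [ContinuousLinearMap.norm_smulRight_apply]
    calc _ ≤ (ε * (2 / ‖x‖)) * ‖x‖ := by
          gcongr
          · exact (ContinuousLinearMap.opNorm_comp_le _ _).trans
              (mul_le_mul h2 hub (norm_nonneg _) hε0)
          · rfl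
      _ = 2 * ε := by field_simp
  exact (add_le_add e1 e2).trans (by linarith)

theorem auxH_norm (f : E → ℝ) (ε : ℝ)
    (hε : ∀ x ∈ sphere (0 : E) 1, |f x| ≤ ε ∧ ‖fderiv ℝ f x‖ ≤ ε) (x : E) :
    ‖auxH f x‖ ≤ ε * ‖x‖ := by
  by_cases hx : x = 0
  · simp [auxH, hx]
  have hs : ‖x‖⁻¹ • x ∈ sphere (0 : E) 1 := by
    rw [mem_sphere_zero_iff_norm, norm_smul, norm_inv, norm_norm,
      inv_mul_cancel₀ (norm_ne_zero_iff.2 hx)]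
  rw [auxH, norm_smul]
  exact mul_le_mul_of_nonneg_right (hε _ hs).1 (norm_nonneg _)

theorem auxH_lip (f : E → ℝ) (hf : ContDiff ℝ 1 f) (ε : ℝ) (hε0 : 0 ≤ ε)
    (hε : ∀ x ∈ sphere (0 : E) 1, |f x| ≤ ε ∧ ‖fderiv ℝ f x‖ ≤ ε) (x y : E) :
    ‖auxH f x - auxH f y‖ ≤ 3 * ε * ‖x - y‖ := by
  by_cases h0 : (0 : E) ∈ segment ℝ x y
  · have hd : ‖x‖ + ‖y‖ = ‖x - y‖ := by
      have := dist_add_dist_of_mem_segment h0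
      simpa [dist_eq_norm] using this
    have h1 := auxH_norm f ε hε x
    have h2 := auxH_norm f ε hε y
    have h3 := norm_sub_le (auxH f x) (auxH f y)
    have h4 : 0 ≤ ε * ‖x - y‖ := by positivity
    have h5 : ε * ‖x‖ + ε * ‖y‖ = ε * ‖x - y‖ := by rw [← hd]; ring
    linarith
  · have hne : ∀ z ∈ segment ℝ x y, z ≠ 0 := fun z hz h => h0 (h ▸ hz)
    exact (convex_segment x y).norm_image_sub_le_of_norm_hasFDerivWithin_le (𝕜 := ℝ)
      (f := auxH f) (f' := fderiv ℝ (auxH f))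
      (fun z hz => ((auxH_contDiffAt f hf z (hne z hz)).differentiableAt
        one_ne_zero).hasFDerivAt.hasFDerivWithinAt)
      (fun z hz => auxH_fderiv f hf ε hε z (hne z hz))
      (right_mem_segment ℝ x y) (left_mem_segment ℝ x y)

theorem auxH_smul (f : E → ℝ) (x : E) (t : ℝ) (ht : 0 < t) :
    auxH f (t • x) = t • auxH f x := by
  unfold auxH
  have : ‖t • x‖⁻¹ • t • x = ‖x‖⁻¹ • x := by
    rw [norm_smul, Real.norm_of_nonneg ht.le, smul_smul, mul_inv_rev, mul_assoc,
      inv_mul_cancel₀ ht.ne', mul_one]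
  rw [this, smul_comm]

theorem auxH_sphere (f : E → ℝ) (x : E) (hx : ‖x‖ = 1) : auxH f x = f x • x := by
  simp [auxH, hx]

/-- A translated nearly round graph is again a radial graph. -/
theorem aux_graph (f : E → ℝ) (hf : ContDiff ℝ 1 f) (ε : ℝ) (hε0 : 0 ≤ ε)
    (hε : ∀ x ∈ sphere (0 : E) 1, |f x| ≤ ε ∧ ‖fderiv ℝ f x‖ ≤ ε) (v : E)
    (hv : ‖v‖ + 3 * ε < 1) :
    ∃ f' : E → ℝ, ContDiff ℝ 1 f' ∧
      (∀ θ ∈ sphere (0 : E) 1, 0 < 1 + f' θ ∧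
        ∃ a ∈ sphere (0 : E) 1, v + (1 + f a) • a = (1 + f' θ) • θ) ∧
      (fun θ : E => v + (1 + f θ) • θ) '' sphere (0 : E) 1
            = (fun θ : E => (1 + f' θ) • θ) '' sphere (0 : E) 1 := by
  set G : E → E := fun x => ‖x‖ • v + auxH f x with hG
  set H : E → E := fun x => x + G x with hH
  have hGlip : ∀ x y, ‖G x - G y‖ ≤ (‖v‖ + 3 * ε) * ‖x - y‖ := by
    intro x y
    have h1 : G x - G y = (‖x‖ - ‖y‖) • v + (auxH f x - auxH f y) := by
      simp only [hG]; module
    rw [h1]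
    refine (norm_add_le _ _).trans ?_
    rw [norm_smul, Real.norm_eq_abs, add_mul]
    have := mul_le_mul_of_nonneg_right (abs_norm_sub_norm_le x y) (norm_nonneg v)
    have := auxH_lip f hf ε hε0 hε x y
    linarith
  let K : NNReal := ⟨‖v‖ + 3 * ε, by positivity⟩
  have happ : ApproximatesLinearOn H
      ((ContinuousLinearEquiv.refl ℝ E : E ≃L[ℝ] E) : E →L[ℝ] E) Set.univ K := by
    intro x _ y _
    have : H x - H y - ((ContinuousLinearEquiv.refl ℝ E : E ≃L[ℝ] E) : E →L[ℝ] E) (x - y)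
        = G x - G y := by
      simp only [hH, ContinuousLinearEquiv.coe_refl, ContinuousLinearMap.id_apply]; abel
    rw [this]
    exact hGlip x y
  have hK : K < ‖(((ContinuousLinearEquiv.refl ℝ E : E ≃L[ℝ] E).symm : E ≃L[ℝ] E) :
      E →L[ℝ] E)‖₊⁻¹ := by
    have h1 : ‖(((ContinuousLinearEquiv.refl ℝ E : E ≃L[ℝ] E).symm : E ≃L[ℝ] E) :
      E →L[ℝ] E)‖₊ = 1 := by
      ext
      simp
    rw [h1, inv_one]
    exact_mod_cast hv
  let Φ : E ≃ₜ E := happ.toHomeomorph H (Or.inr hK)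
  have hΦ : ∀ x, Φ x = H x := fun x => rfl
  have hH0 : H 0 = 0 := by simp [hH, hG, auxH]
  have hsymm0 : ∀ x, x ≠ 0 → Φ.symm x ≠ 0 := by
    intro x hx h
    apply hx
    rw [← Φ.apply_symm_apply x, h, hΦ, hH0]
  have hsymm_cd : ∀ x, x ≠ 0 → ContDiffAt ℝ 1 Φ.symm x := by
    intro x hx
    have h0 := hsymm0 x hx
    have hGc : ContDiffAt ℝ 1 G (Φ.symm x) :=
      ((contDiffAt_norm ℝ h0).smul contDiffAt_const).add (auxH_contDiffAt f hf _ h0)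
    have hHc : ContDiffAt ℝ 1 H (Φ.symm x) := contDiffAt_id.add hGc
    have hGd := (hGc.differentiableAt one_ne_zero).hasFDerivAt
    have hGn : ‖fderiv ℝ G (Φ.symm x)‖ < 1 :=
      (norm_fderiv_le_of_lip' ℝ (by positivity)
        (Filter.Eventually.of_forall fun y => hGlip y _)).trans_lt hv
    let u := Units.oneSub (-(fderiv ℝ G (Φ.symm x))) (by rwa [norm_neg])
    let e := ContinuousLinearEquiv.ofUnit u
    have he : HasFDerivAt H (e : E →L[ℝ] E) (Φ.symm x) := by
      have h1 := (hasFDerivAt_id (𝕜 := ℝ) (Φ.symm x)).add hGd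
      have h2 : (e : E →L[ℝ] E) = ContinuousLinearMap.id ℝ E + fderiv ℝ G (Φ.symm x) := by
        ext1 y
        change (1 - -(fderiv ℝ G (Φ.symm x))) y = _
        simp
      rw [h2]
      exact h1
    exact Φ.toOpenPartialHomeomorph.contDiffAt_symm (f₀' := e) (a := x) (by simp) he hHc
  have hhom : ∀ (t : ℝ) (x : E), 0 < t → H (t • x) = t • H x := by
    intro t x ht
    simp only [hH, hG, auxH_smul f x t ht, norm_smul, Real.norm_of_nonneg ht.le]
    module
  have hHs : ∀ a : E, ‖a‖ = 1 → H a = v + (1 + f a) • a := by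
    intro a ha
    simp only [hH, hG, auxH_sphere f a ha, ha]
    module
  let b : ContDiffBump (0 : E) := ⟨1/4, 1/2, by norm_num, by norm_num⟩
  let f' : E → ℝ := fun x => (1 - b x) * (‖Φ.symm x‖⁻¹ - 1)
  have hf's : ∀ θ : E, ‖θ‖ = 1 → 1 + f' θ = ‖Φ.symm θ‖⁻¹ := by
    intro θ hθ
    have : b θ = 0 := b.zero_of_le_dist (by simp [hθ, b]; norm_num)
    simp [f', this]
  have hf'c : ContDiff ℝ 1 f' := by
    rw [contDiff_iff_contDiffAt]
    intro x
    by_cases hx : x = 0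
    · have h1 : f' =ᶠ[nhds x] fun _ => 0 := by
        have := b.eventuallyEq_one
        rw [hx]
        filter_upwards [this] with y hy
        simp [f', hy]
      exact contDiffAt_const.congr_of_eventuallyEq h1
    · have h1 : ContDiffAt ℝ 1 (fun y => ‖Φ.symm y‖⁻¹) x :=
        ((hsymm_cd x hx).norm ℝ (hsymm0 x hx)).inv (norm_ne_zero_iff.2 (hsymm0 x hx))
      exact (contDiffAt_const.sub b.contDiffAt).mul (h1.sub contDiffAt_const)
  have hmain : ∀ θ ∈ sphere (0 : E) 1, 0 < 1 + f' θ ∧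
        ∃ a ∈ sphere (0 : E) 1, v + (1 + f a) • a = (1 + f' θ) • θ := by
    intro θ hθ
    have hθ1 : ‖θ‖ = 1 := by simpa using hθ
    have hne : Φ.symm θ ≠ 0 := hsymm0 θ (by rintro rfl; simp at hθ1)
    have hpos : 0 < ‖Φ.symm θ‖ := norm_pos_iff.2 hne
    have ha : ‖‖Φ.symm θ‖⁻¹ • Φ.symm θ‖ = 1 := by
      rw [norm_smul, norm_inv, norm_norm, inv_mul_cancel₀ hpos.ne']
    rw [hf's θ hθ1]
    refine ⟨inv_pos.2 hpos, ‖Φ.symm θ‖⁻¹ • Φ.symm θ, by simpa using ha, ?_⟩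
    rw [← hHs _ ha, hhom _ _ (inv_pos.2 hpos), ← hΦ, Φ.apply_symm_apply]
  refine ⟨f', hf'c, hmain, ?_⟩
  apply Set.Subset.antisymm
  · rintro _ ⟨a, ha, rfl⟩
    have ha1 : ‖a‖ = 1 := by simpa using ha
    have hHa : H a ≠ 0 := by
      intro h
      have : a = 0 := Φ.injective (by rw [hΦ, hΦ, h, hH0])
      simp [this] at ha1
    have hpos : 0 < ‖H a‖ := norm_pos_iff.2 hHa
    have hθ : ‖‖H a‖⁻¹ • H a‖ = 1 := by
      rw [norm_smul, norm_inv, norm_norm, inv_mul_cancel₀ hpos.ne']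
    refine ⟨‖H a‖⁻¹ • H a, by simpa using hθ, ?_⟩
    have hs : Φ.symm (‖H a‖⁻¹ • H a) = ‖H a‖⁻¹ • a := by
      rw [← hhom _ _ (inv_pos.2 hpos), ← hΦ, Φ.symm_apply_apply]
    simp only
    rw [hf's _ hθ, hs, norm_smul, norm_inv, norm_norm, ha1, mul_one, inv_inv, smul_smul,
      mul_inv_cancel₀ hpos.ne', one_smul, hHs a ha1]
  · rintro _ ⟨θ, hθ, rfl⟩
    obtain ⟨-, a, ha, h⟩ := hmain θ hθ
    exact ⟨a, ha, h⟩

theorem aux_radius (f : E → ℝ) (ε : ℝ) 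
    (hε : ∀ x ∈ sphere (0 : E) 1, |f x| ≤ ε ∧ ‖fderiv ℝ f x‖ ≤ ε) (v θ a : E) (R : ℝ)
    (hR : 0 < R) (hθ : ‖θ‖ = 1) (ha : ‖a‖ = 1) (h : v + (1 + f a) • a = R • θ) :
    |R - 1| ≤ ‖v‖ + ε ∧ ‖a - θ‖ ≤ 2 * (‖v‖ + ε) := by
  have hfa := (hε a (by simpa using ha)).1
  have h1 : R • θ - a = v + f a • a := by rw [← h]; module
  have h2 : ‖R • θ - a‖ ≤ ‖v‖ + ε := by
    rw [h1]
    refine (norm_add_le _ _).trans ?_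
    rw [norm_smul, ha, mul_one, Real.norm_eq_abs]
    linarith
  have h3 : |R - 1| ≤ ‖v‖ + ε := by
    have := abs_norm_sub_norm_le (R • θ) a
    rw [norm_smul, hθ, ha, mul_one, Real.norm_of_nonneg hR.le] at this
    linarith
  refine ⟨h3, ?_⟩
  have h4 : a - θ = (R - 1) • θ - (R • θ - a) := by module
  rw [h4]
  refine (norm_sub_le _ _).trans ?_
  rw [norm_smul, hθ, mul_one, Real.norm_eq_abs]
  linarith

theorem aux_diff (f : E → ℝ) (hf : ContDiff ℝ 1 f) (ε r : ℝ) (hε0 : 0 ≤ ε)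
    (hε : ∀ x ∈ sphere (0 : E) 1, |f x| ≤ ε ∧ ‖fderiv ℝ f x‖ ≤ ε)
    (hr : 2 * r + 5 * ε ≤ 1 / 20)
    (v w θ a b : E) (R S : ℝ) (hv : ‖v‖ ≤ r) (hw : ‖w‖ ≤ r)
    (hR : 0 < R) (hS : 0 < S) (hθ : ‖θ‖ = 1) (ha : ‖a‖ = 1) (hb : ‖b‖ = 1)
    (h : v + (1 + f a) • a = R • θ) (h' : w + (1 + f b) • b = S • θ) :
    |inner ℝ θ (v - w) - (R - S)| ≤ 1 / 9 * ‖v - w‖ := by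
  have hra := (aux_radius f ε hε v θ a R hR hθ ha h).2
  have hrb := (aux_radius f ε hε w θ b S hS hθ hb h').2
  have hlip := auxH_lip f hf ε hε0 hε a b
  rw [auxH_sphere f a ha, auxH_sphere f b hb] at hlip
  set q : E := f a • a - f b • b with hq
  have e1 : a - b = (R - S) • θ - (v - w) - q := by
    have : (R - S) • θ = (v + (1 + f a) • a) - (w + (1 + f b) • b) := by rw [h, h']; module
    rw [this, hq]; module
  set s := ‖a - b‖ with hs
  set D := |inner ℝ θ (v - w) - (R - S)| with hD
  have e2 : inner ℝ θ (a - b) = (R - S) - inner ℝ θ (v - w) - inner ℝ θ q := by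
    rw [e1, inner_sub_right, inner_sub_right, inner_smul_right, real_inner_self_eq_norm_sq, hθ]
    ring
  have e3 : inner ℝ (a + b) (a - b) = 0 := by
    rw [inner_add_left, inner_sub_right, inner_sub_right, real_inner_self_eq_norm_sq,
      real_inner_self_eq_norm_sq, ha, hb, real_inner_comm]
    ring
  have e4 : 2 * inner ℝ θ (a - b) = - inner ℝ ((a - θ) + (b - θ)) (a - b) := by
    have : (a - θ) + (b - θ) = (a + b) - (2 : ℝ) • θ := by module
    rw [this, inner_sub_left, e3, real_inner_smul_left]
    ring
  have e5 : |inner ℝ ((a - θ) + (b - θ)) (a - b)| ≤ (4 * (r + ε)) * s := by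
    refine (abs_real_inner_le_norm _ _).trans ?_
    refine mul_le_mul_of_nonneg_right ?_ (norm_nonneg _)
    refine (norm_add_le _ _).trans ?_
    linarith
  have e6 : |inner ℝ θ q| ≤ 3 * ε * s := by
    refine (abs_real_inner_le_norm _ _).trans ?_
    rw [hθ, one_mul]
    exact hlip
  have e7 : D ≤ (2 * r + 5 * ε) * s := by
    rw [abs_le] at e5 e6
    rw [hD, abs_le]
    constructor <;> nlinarith
  have hs0 : 0 ≤ s := norm_nonneg _
  have e8 : |R - S| ≤ D + ‖v - w‖ := by
    have h1 := abs_real_inner_le_norm θ (v - w)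
    rw [hθ, one_mul] at h1
    have h2 : R - S = inner ℝ θ (v - w) - (inner ℝ θ (v - w) - (R - S)) := by ring
    rw [h2]
    have := abs_sub (inner ℝ θ (v - w)) (inner ℝ θ (v - w) - (R - S))
    linarith
  have e9 : s ≤ D + 2 * ‖v - w‖ + 3 * ε * s := by
    have h1 : s ≤ ‖(R - S) • θ‖ + ‖v - w‖ + ‖q‖ := by
      rw [hs, e1]
      exact (norm_sub_le _ _).trans (add_le_add_left (norm_sub_le _ _) _)
    rw [norm_smul, hθ, mul_one, Real.norm_eq_abs] at h1
    linarith
  have hr0 : 0 ≤ r := (norm_nonneg v).trans hv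
  have e10 : D ≤ 1 / 20 * s := e7.trans (mul_le_mul_of_nonneg_right hr hs0)
  have e11 : 3 * ε * s ≤ 1 / 20 * s := mul_le_mul_of_nonneg_right (by linarith) hs0
  linarith

theorem aux_finite : (μH[2] : Measure E) (sphere (0 : E) 1) < ⊤ := by
  let P : (Fin 2 → ℝ) → E := fun p =>
    !₂[Real.cos (p 0) * Real.cos (p 1), Real.cos (p 0) * Real.sin (p 1), Real.sin (p 0)]
  let Q : Set (Fin 2 → ℝ) := Set.Icc (fun _ => -Real.pi) (fun _ => Real.pi)
  have hP : ContDiff ℝ 1 P := by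
    rw [contDiff_euclidean]
    intro i
    fin_cases i <;> simp [P] <;> fun_prop
  obtain ⟨K, hK⟩ := (hP.locallyLipschitz.locallyLipschitzOn (s := Q)).exists_lipschitzOnWith_of_compact
    isCompact_Icc
  have hsub : sphere (0 : E) 1 ⊆ P '' Q := by
    intro x hx
    have hx1 : ‖x‖ = 1 := by simpa using hx
    have hsq : x 0 ^ 2 + x 1 ^ 2 + x 2 ^ 2 = 1 := by
      have := EuclideanSpace.real_norm_sq_eq x
      rw [hx1, Fin.sum_univ_three] at this
      linarith
    let z : ℂ := ⟨x 0, x 1⟩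
    have hz : ‖z‖ = Real.sqrt (1 - x 2 ^ 2) := by
      rw [Complex.norm_def, Complex.normSq_mk]
      congr 1
      linarith
    refine ⟨![Real.arcsin (x 2), Complex.arg z], ⟨?_, ?_⟩, ?_⟩
    · intro i
      have h1 := Real.neg_pi_div_two_le_arcsin (x 2)
      have h2 := Complex.neg_pi_lt_arg z
      have := Real.pi_pos
      fin_cases i <;> simp <;> linarith
    · intro i
      have h1 := Real.arcsin_le_pi_div_two (x 2)
      have h2 := Complex.arg_le_pi z
      have := Real.pi_pos
      fin_cases i <;> simp <;> linarith
    · ext i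
      fin_cases i
      · simp [P, Real.cos_arcsin, ← hz, Complex.norm_mul_cos_arg, z]
      · simp [P, Real.cos_arcsin, ← hz, Complex.norm_mul_sin_arg, z]
      · simp only [P]
        simp
        exact Real.sin_arcsin (by nlinarith [sq_nonneg (x 0), sq_nonneg (x 1)])
          (by nlinarith [sq_nonneg (x 0), sq_nonneg (x 1)])
  refine (measure_mono hsub).trans_lt ?_
  refine (hK.hausdorffMeasure_image_le (by norm_num)).trans_lt ?_
  have hvol : (μH[2] : Measure (Fin 2 → ℝ)) = volume := by
    have := hausdorffMeasure_pi_real (ι := Fin 2)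
    simpa using this
  rw [hvol]
  exact ENNReal.mul_lt_top (by simp) (isCompact_Icc.measure_lt_top)

/-- surface measure on the sphere -/
abbrev auxμ : Measure E := (μH[2] : Measure E).restrict (sphere (0 : E) 1)

instance : IsFiniteMeasure auxμ := ⟨by simpa using aux_finite⟩

theorem auxμ_inv (e : E ≃ₗᵢ[ℝ] E) (g : E → ℝ) : ∫ x, g (e x) ∂auxμ = ∫ x, g x ∂auxμ := by
  have h := (e.toIsometryEquiv.measurePreserving_hausdorffMeasure 2).setIntegral_preimage_emb
    e.toHomeomorph.measurableEmbedding g (sphere (0 : E) 1)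
  have h2 : (e.toIsometryEquiv ⁻¹' sphere (0 : E) 1) = sphere (0 : E) 1 := by
    ext x; simp
  rw [h2] at h
  exact h

theorem auxμ_integrable {F : Type*} [NormedAddCommGroup F] (g : E → F)
    (hg : Continuous g) : Integrable g auxμ := by
  have h := hg.continuousOn.integrableOn_compact (μ := auxμ) (isCompact_sphere (0 : E) 1)
  rwa [IntegrableOn, Measure.restrict_restrict isClosed_sphere.measurableSet,
    Set.inter_self] at h

theorem auxμ_off (i j : Fin 3) (hij : i ≠ j) : ∫ x : E, x i * x j ∂auxμ = 0 := by
  let e : E ≃ₗᵢ[ℝ] E := LinearIsometryEquiv.piLpCongrRight 2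
    (fun k => if k = i then LinearIsometryEquiv.neg ℝ else LinearIsometryEquiv.refl ℝ ℝ)
  have h := auxμ_inv e (fun x => x i * x j)
  have h2 : ∀ x : E, e x i * e x j = - (x i * x j) := by
    intro x
    simp [e, hij.symm]
  simp only [h2, integral_neg] at h
  linarith

theorem auxμ_swap (i j : Fin 3) : ∫ x : E, x i * x i ∂auxμ = ∫ x : E, x j * x j ∂auxμ := by
  let e : E ≃ₗᵢ[ℝ] E := LinearIsometryEquiv.piLpCongrLeft 2 ℝ ℝ (Equiv.swap i j)
  have h := auxμ_inv e (fun x => x i * x i)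
  have h2 : ∀ x : E, e x i = x j := by
    intro x
    simp [e]
  simp only [h2] at h
  exact h.symm

theorem auxμ_diag (i : Fin 3) : 3 * ∫ x : E, x i * x i ∂auxμ = auxμ.real Set.univ := by
  have hint : ∀ k : Fin 3, Integrable (fun x : E => x k * x k) auxμ :=
    fun k => auxμ_integrable _ (by fun_prop)
  have h1 : ∫ x : E, ∑ k, x k * x k ∂auxμ = ∫ _ : E, (1 : ℝ) ∂auxμ := by
    refine setIntegral_congr_fun isClosed_sphere.measurableSet fun x hx => ?_
    have hx1 : ‖x‖ = 1 := by simpa using hx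
    have := EuclideanSpace.real_norm_sq_eq x
    rw [hx1] at this
    simp only [← pow_two]
    rw [← this]; norm_num
  rw [integral_finsetSum _ (fun k _ => hint k)] at h1
  rw [Finset.sum_congr rfl (fun k _ => auxμ_swap k i)] at h1
  simpa using h1

theorem auxμ_inner (v : E) :
    ∫ x : E, (inner ℝ x v : ℝ) • x ∂auxμ = (auxμ.real Set.univ / 3) • v := by
  ext i
  have h := (EuclideanSpace.proj i : E →L[ℝ] ℝ).integral_comp_comm
    (auxμ_integrable (fun x : E => (inner ℝ x v : ℝ) • x) (by fun_prop))
  have h' : (∫ x : E, (inner ℝ x v : ℝ) • x ∂auxμ) i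
      = ∫ x : E, ((inner ℝ x v : ℝ) • x) i ∂auxμ := h.symm
  rw [h']
  have h2 : ∀ x : E, ((inner ℝ x v : ℝ) • x) i = ∑ k, v k * (x k * x i) := by
    intro x
    simp [PiLp.inner_apply, Finset.sum_mul]
    refine Finset.sum_congr rfl fun k _ => by ring
  simp only [h2]
  rw [integral_finsetSum _ (fun k _ => (auxμ_integrable _ (by fun_prop)))]
  rw [Finset.sum_eq_single i]
  · rw [integral_const_mul, ← auxμ_diag i]
    simp
    ring
  · intro k _ hk
    rw [integral_const_mul, auxμ_off k i hk, mul_zero]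
  · simp

/-- Centering a nearly-round radial graph by a small translation: for every
`δ ∈ (0, 1/2)` there is `ε > 0` such that whenever the radial graph
`Σ = {(1 + f(θ))θ : θ ∈ S²}` is given by a `C¹` function `f` with
`‖f‖_{C¹} ≤ ε`, there exists `v` with `|v| ≤ δ` such that the translate
`Σ + v` is again a radial graph `{(1 + f'(θ))θ : θ ∈ S²}` over the unit sphere,
with `∫_{S²} xⁱ f' = 0` for `i = 1, 2, 3` (vanishing first spherical
harmonics). The integrals are with respect to the surface (2-dimensional
Hausdorff) measure on `S²`. -/
theorem stmt15 (δ : ℝ) (hδ : δ ∈ Set.Ioo (0 : ℝ) (1 / 2)) :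
    ∃ ε > (0 : ℝ), ∀ f : E → ℝ, ContDiff ℝ 1 f →
      (∀ x ∈ sphere (0 : E) 1, |f x| ≤ ε ∧ ‖fderiv ℝ f x‖ ≤ ε) →
      ∃ v : E, ‖v‖ ≤ δ ∧
        ∃ f' : E → ℝ, ContDiff ℝ 1 f' ∧
          (fun θ : E => v + (1 + f θ) • θ) '' sphere (0 : E) 1
            = (fun θ : E => (1 + f' θ) • θ) '' sphere (0 : E) 1 ∧
          ∀ i : Fin 3, ∫ x in sphere (0 : E) 1, x i * f' x ∂μH[2] = 0 := by
  obtain ⟨hδ0, hδ1⟩ := hδ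
  set r : ℝ := min δ (1 / 100) with hr
  have hr0 : 0 < r := lt_min hδ0 (by norm_num)
  have hrδ : r ≤ δ := min_le_left _ _
  have hr1 : r ≤ 1 / 100 := min_le_right _ _
  refine ⟨r / 10, by positivity, fun f hf hε => ?_⟩
  set ε : ℝ := r / 10 with hεr
  have hε0 : 0 ≤ ε := by positivity
  have hg : ∀ v : E, ∃ f' : E → ℝ, ‖v‖ ≤ r → (ContDiff ℝ 1 f' ∧
      (∀ θ ∈ sphere (0 : E) 1, 0 < 1 + f' θ ∧
        ∃ a ∈ sphere (0 : E) 1, v + (1 + f a) • a = (1 + f' θ) • θ) ∧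
      (fun θ : E => v + (1 + f θ) • θ) '' sphere (0 : E) 1
            = (fun θ : E => (1 + f' θ) • θ) '' sphere (0 : E) 1) := by
    intro v
    by_cases hv : ‖v‖ ≤ r
    · obtain ⟨f', h⟩ := aux_graph f hf ε hε0 hε v (by linarith)
      exact ⟨f', fun _ => h⟩
    · exact ⟨f, fun h => absurd h hv⟩
  choose F hF using hg
  -- it suffices to find `v` with vanishing vector-valued integral
  suffices hmain : ∃ v : E, ‖v‖ ≤ r ∧ ∫ x, F v x • x ∂auxμ = 0 by
    obtain ⟨v, hv, hint⟩ := hmain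
    obtain ⟨hc, -, him⟩ := hF v hv
    refine ⟨v, hv.trans hrδ, F v, hc, him, fun i => ?_⟩
    have h := (EuclideanSpace.proj i : E →L[ℝ] ℝ).integral_comp_comm
      (auxμ_integrable (fun x : E => F v x • x) (hc.continuous.smul continuous_id))
    rw [hint, map_zero] at h
    rw [← h]
    refine integral_congr_ae (Filter.Eventually.of_forall fun x => ?_)
    simp [mul_comm]
  set m : ℝ := auxμ.real Set.univ with hm
  by_cases hm0 : m = 0
  · have hz : auxμ = 0 := by
      rw [hm, measureReal_eq_zero_iff] at hm0
      exact Measure.measure_univ_eq_zero.1 hm0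
    exact ⟨0, by simpa using hr0.le, by rw [hz, integral_zero_measure]⟩
  have hmpos : 0 < m := lt_of_le_of_ne measureReal_nonneg (Ne.symm hm0)
  have hI : ∀ v : E, ‖v‖ ≤ r → Integrable (fun x : E => F v x • x) auxμ := fun v hv =>
    auxμ_integrable _ ((hF v hv).1.continuous.smul continuous_id)
  let Ξ : E → E := fun v => v - (3 / m) • ∫ x, F v x • x ∂auxμ
  have hsph : ∀ᵐ x ∂auxμ, x ∈ sphere (0 : E) 1 := ae_restrict_mem isClosed_sphere.measurableSet
  have hΞ : ∀ v w : E, ‖v‖ ≤ r → ‖w‖ ≤ r → ‖Ξ v - Ξ w‖ ≤ 1 / 3 * ‖v - w‖ := by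
    intro v w hv hw
    have h1 : Ξ v - Ξ w =
        (3 / m) • ∫ x : E, (inner ℝ x (v - w) - (F v x - F w x)) • x ∂auxμ := by
      have hin : Integrable (fun x : E => (inner ℝ x (v - w) : ℝ) • x) auxμ :=
        auxμ_integrable _ (by fun_prop)
      have h2 : ∫ x : E, (inner ℝ x (v - w) - (F v x - F w x)) • x ∂auxμ
          = ∫ x : E, (inner ℝ x (v - w) : ℝ) • x ∂auxμ
            - (∫ x, F v x • x ∂auxμ - ∫ x, F w x • x ∂auxμ) := by
        have hvw : Integrable (fun x : E => F v x • x - F w x • x) auxμ :=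
          (hI v hv).sub (hI w hw)
        rw [← integral_sub (hI v hv) (hI w hw), ← integral_sub hin hvw]
        refine integral_congr_ae (Filter.Eventually.of_forall fun x => ?_)
        simp only [sub_smul]
      rw [h2, auxμ_inner, smul_sub, smul_smul, ← hm]
      have h3 : 3 / m * (m / 3) = 1 := by field_simp
      rw [h3]
      simp only [Ξ]
      module
    have h4 : ‖∫ x : E, (inner ℝ x (v - w) - (F v x - F w x)) • x ∂auxμ‖
        ≤ (1 / 9 * ‖v - w‖) * m := by
      refine norm_integral_le_of_norm_le_const ?_
      filter_upwards [hsph] with θ hθ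
      have hθ1 : ‖θ‖ = 1 := by simpa using hθ
      obtain ⟨hR, a, ha, hav⟩ := (hF v hv).2.1 θ hθ
      obtain ⟨hS, b, hb, hbw⟩ := (hF w hw).2.1 θ hθ
      have := aux_diff f hf ε r hε0 hε (by linarith) v w θ a b _ _ hv hw hR hS hθ1
        (by simpa using ha) (by simpa using hb) hav hbw
      rw [norm_smul, hθ1, mul_one, Real.norm_eq_abs]
      have h5 : (1 + F v θ) - (1 + F w θ) = F v θ - F w θ := by ring
      rwa [h5] at this
    rw [h1, norm_smul, Real.norm_of_nonneg (by positivity)]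
    calc 3 / m * _ ≤ 3 / m * ((1 / 9 * ‖v - w‖) * m) := by gcongr
      _ = 1 / 3 * ‖v - w‖ := by field_simp; norm_num
  have hΞ0 : ‖Ξ 0‖ ≤ 3 * ε := by
    have h1 : ‖∫ x, F 0 x • x ∂auxμ‖ ≤ ε * m := by
      refine norm_integral_le_of_norm_le_const ?_
      filter_upwards [hsph] with θ hθ
      have hθ1 : ‖θ‖ = 1 := by simpa using hθ
      obtain ⟨hR, a, ha, hav⟩ := (hF 0 (by simpa using hr0.le)).2.1 θ hθ
      have := (aux_radius f ε hε 0 θ a _ hR hθ1 (by simpa using ha) hav).1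
      rw [norm_smul, hθ1, mul_one, Real.norm_eq_abs]
      simpa using this
    simp only [Ξ]
    rw [zero_sub, norm_neg, norm_smul, Real.norm_of_nonneg (by positivity)]
    calc 3 / m * _ ≤ 3 / m * (ε * m) := by gcongr
      _ = 3 * ε := by field_simp
  have hmaps : Set.MapsTo Ξ (closedBall (0 : E) r) (closedBall (0 : E) r) := by
    intro v hv
    rw [mem_closedBall_zero_iff] at hv ⊢
    have h1 := hΞ v 0 hv (by simpa using hr0.le)
    rw [sub_zero] at h1
    have h2 : ‖Ξ v‖ ≤ ‖Ξ v - Ξ 0‖ + ‖Ξ 0‖ := by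
      simpa using norm_add_le (Ξ v - Ξ 0) (Ξ 0)
    linarith
  have hcontr : ContractingWith (1 / 3 : NNReal) (hmaps.restrict Ξ _ _) := by
    refine ⟨by rw [← NNReal.coe_lt_coe]; norm_num, LipschitzWith.of_dist_le_mul ?_⟩
    rintro ⟨v, hv⟩ ⟨w, hw⟩
    rw [mem_closedBall_zero_iff] at hv hw
    have := hΞ v w hv hw
    simpa [Subtype.dist_eq, dist_eq_norm] using this
  obtain ⟨v, hv, hfix, -⟩ := hcontr.exists_fixedPoint' isClosed_closedBall.isComplete hmaps
    (mem_closedBall_self hr0.le) (edist_ne_top _ _)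
  refine ⟨v, by simpa using hv, ?_⟩
  have h1 : v - (3 / m) • ∫ x, F v x • x ∂auxμ = v := hfix
  have h2 : (3 / m) • ∫ x, F v x • x ∂auxμ = 0 := by simpa using h1
  exact (smul_eq_zero.1 h2).resolve_left (by positivity)
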